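/- arXiv:1406.7598 — 2 statements merged into one kernel-verified Lean document; each statement's English description precedes it below -/
import Mathlib

section
/- Let V be a finite-dimensional real inner product space with dim V ≥ 2, let δ ∈ ℝ with δ ≠ 0, let B, B* : V → V be self-adjoint linear endomorphisms with B ∘ B* = B* ∘ B, and let τ* : V → ℝ be a linear functional. Assume: (i) δ(⟨Y,Z⟩X − ⟨X,Z⟩Y) = ⟨BX,Z⟩·B*Y − ⟨BY,Z⟩·B*X for all X, Y, Z ∈ V, and (ii) τ*(X)·B*Y = τ*(Y)·B*X for all X, Y ∈ V. Then τ* = 0. -/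
open RealInnerProductSpace

/-- Linear-algebra core of Theorem 4.1: under the Gauss-type relation (i) with
`δ ≠ 0` and the Codazzi-type relation (ii), the transversal form `τ*` vanishes. -/
theorem equiaffine_of_constant_curvature_hypersurface
    {V : Type*} [NormedAddCommGroup V] [InnerProductSpace ℝ V]
    [FiniteDimensional ℝ V] (hdim : 2 ≤ Module.finrank ℝ V)
    (δ : ℝ) (hδ : δ ≠ 0)
    (B Bstar : V →ₗ[ℝ] V)
    (hB : LinearMap.IsSymmetric B) (hBstar : LinearMap.IsSymmetric Bstar)
    (hcomm : B ∘ₗ Bstar = Bstar ∘ₗ B)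
    (τstar : V →ₗ[ℝ] ℝ)
    (hi : ∀ X Y Z : V, δ • (⟪Y, Z⟫ • X - ⟪X, Z⟫ • Y)
      = ⟪B X, Z⟫ • Bstar Y - ⟪B Y, Z⟫ • Bstar X)
    (hii : ∀ X Y : V, τstar X • Bstar Y = τstar Y • Bstar X) :
    τstar = 0 := by
  have key : ∀ f : V →ₗ[ℝ] ℝ, ∃ v : V, v ≠ 0 ∧ f v = 0 := by
    intro f
    have h : LinearMap.ker f ≠ ⊥ := by
      apply LinearMap.ker_ne_bot_of_finrank_lt
      rw [Module.finrank_self]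
      omega
    obtain ⟨v, hv, hv0⟩ := Submodule.exists_mem_ne_zero_of_ne_bot h
    exact ⟨v, hv0, hv⟩
  ext X0
  by_contra hX0
  simp only [LinearMap.zero_apply] at hX0
  obtain ⟨Y, hY0, hY⟩ := key τstar
  have hBY : Bstar Y = 0 := by
    have h := hii X0 Y
    rw [hY, zero_smul] at h
    exact (smul_eq_zero.mp h).resolve_left hX0
  obtain ⟨X, hX, hXY⟩ := key (innerₗ V Y)
  have hXY' : ⟪Y, X⟫ = 0 := hXY
  have h := congrArg (fun v => ⟪v, Y⟫) (hi X Y X)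
  have h2 : ⟪Bstar X, Y⟫ = 0 := by rw [hBstar X Y, hBY, inner_zero_right]
  simp only [hXY', hBY, zero_smul, smul_zero, zero_sub, inner_neg_left, inner_smul_left, h2,
    smul_neg] at h
  simp [hδ, hX, hY0] at h
end

section
/- Let V be a real inner product space, δ ∈ ℝ, and B, B* : V → V linear endomorphisms such that δ(⟨Y,Z⟩X − ⟨X,Z⟩Y) = ⟨BX,Z⟩·B*Y − ⟨BY,Z⟩·B*X for all X, Y, Z ∈ V. Suppose X₁, X₂ ∈ V are orthonormal vectors with B X_j = λ_j X_j and B* X_j = λ_j* X_j for j = 1, 2, where λ_j, λ_j* ∈ ℝ. Then λ₁ λ₂* = −δ and λ₂ λ₁* = −δ. -/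
open RealInnerProductSpace

/-- Eigenvalue computation in the proof of Theorem 4.1: evaluating the curvature
relation on common orthonormal eigenvectors of `B` and `B*` forces
`λ₁λ₂* = λ₂λ₁* = −δ`. -/
theorem eigenvalue_relation_of_curvature
    {V : Type*} [NormedAddCommGroup V] [InnerProductSpace ℝ V]
    (δ : ℝ) (B Bstar : V →ₗ[ℝ] V)
    (h : ∀ X Y Z : V, δ • (⟪Y, Z⟫ • X - ⟪X, Z⟫ • Y)
      = ⟪B X, Z⟫ • Bstar Y - ⟪B Y, Z⟫ • Bstar X)
    (X₁ X₂ : V) (h₁₁ : ⟪X₁, X₁⟫ = 1) (h₂₂ : ⟪X₂, X₂⟫ = 1) (h₁₂ : ⟪X₁, X₂⟫ = 0)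
    (l₁ l₂ l₁s l₂s : ℝ)
    (hB₁ : B X₁ = l₁ • X₁) (hB₂ : B X₂ = l₂ • X₂)
    (hBs₁ : Bstar X₁ = l₁s • X₁) (hBs₂ : Bstar X₂ = l₂s • X₂) :
    l₁ * l₂s = -δ ∧ l₂ * l₁s = -δ := by
  have h₂₁ : ⟪X₂, X₁⟫ = 0 := by rw [real_inner_comm]; exact h₁₂
  constructor
  · have e := congrArg (fun v => ⟪v, X₂⟫) (h X₁ X₂ X₁)
    simp only [hB₁, hB₂, hBs₁, hBs₂, inner_sub_left, real_inner_smul_left,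
      h₁₁, h₂₂, h₁₂, h₂₁] at e
    linarith
  · have e := congrArg (fun v => ⟪v, X₁⟫) (h X₁ X₂ X₂)
    simp only [hB₁, hB₂, hBs₁, hBs₂, inner_sub_left, real_inner_smul_left,
      h₁₁, h₂₂, h₁₂, h₂₁] at e
    linarith
end
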